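/- arXiv:2011.11727 — 2 statements merged into one kernel-verified Lean document; each statement's English description precedes it below -/
import Mathlib

section
/- Let q = p^m ≥ 3 be a power of the prime p, let r ≥ 1, and let α ∈ F_{q^r} satisfy Tr_{F_{q^r}/F_q}(α) ≠ 0. Then T^q − T − α factors in F_{q^r}[T] as the product of q/p distinct monic irreducible polynomials, each of the form T^p − βT − γ_i where β = (Tr_{F_{q^r}/F_q}(α))^{p−1} and γ_1, …, γ_{q/p} are distinct nonzero elements of F_{q^r}. -/
open Polynomial

/-- An element of an extension of a finite field `K` fixed by the `#K`-power map lies in `K`. -/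
theorem FiniteField.exists_algebraMap_eq_of_pow_card_eq {K L : Type*} [Field K] [Fintype K]
    [Field L] [Algebra K L] {z : L} (hz : z ^ Fintype.card K = z) :
    ∃ c : K, algebraMap K L c = z := by
  have hprod : (X ^ Fintype.card K - X : K[X]) = ∏ a : K, (X - C a) := by
    refine Polynomial.eq_of_degree_le_of_eval_finset_eq Finset.univ ?_ ?_ ?_ ?_
    · refine (degree_sub_le _ _).trans (max_le (by simp) ?_)
      simpa [degree_X] using Nat.one_le_iff_ne_zero.2 Fintype.card_ne_zero
    · rw [degree_prod, degree_sub_eq_left_of_degree_lt]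
      · simp
      · simpa [degree_X] using Fintype.one_lt_card (α := K)
    · rw [(monic_prod_of_monic _ _ fun a _ => monic_X_sub_C a).leadingCoeff,
        leadingCoeff_sub_of_degree_lt]
      · simp
      · simpa [degree_X] using Fintype.one_lt_card (α := K)
    · intro a _
      rw [eval_prod, Finset.prod_eq_zero (Finset.mem_univ a) (by simp)]
      simp [FiniteField.pow_card]
  have h := congrArg (aeval z) hprod
  simp only [map_sub, map_pow, aeval_X, hz, sub_self, map_prod, aeval_C] at h
  obtain ⟨c, -, hc⟩ := Finset.prod_eq_zero_iff.1 h.symm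
  exact ⟨c, (sub_eq_zero.1 hc).symm⟩

/-- The Frobenius of `K` translates the roots of `X ^ #F - X - α` by the trace of `α`. -/
theorem FiniteField.pow_card_eq_add_trace {F K L : Type*} [Field F] [Fintype F] [Field K]
    [Fintype K] [Field L] [Algebra F K] [Algebra K L] {α : K} {x : L}
    (hx : x ^ Fintype.card F = x + algebraMap K L α) :
    x ^ Fintype.card K = x + algebraMap K L (algebraMap F K (Algebra.trace F K α)) := by
  let _ : Algebra F L := ((algebraMap K L).comp (algebraMap F K)).toAlgebra
  let φ := FiniteField.frobeniusAlgHom F L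
  have hφ (y : L) : φ y = y ^ Fintype.card F := rfl
  have key (n : ℕ) : x ^ Fintype.card F ^ n =
      x + algebraMap K L (∑ i ∈ Finset.range n, α ^ Fintype.card F ^ i) := by
    induction n with
    | zero => simp
    | succ n ih =>
      have hsum := congrArg φ ih
      have hpow : (∑ i ∈ Finset.range n, α ^ Fintype.card F ^ i) ^ Fintype.card F =
          ∑ i ∈ Finset.range n, (α ^ Fintype.card F ^ i) ^ Fintype.card F :=
        map_sum (FiniteField.frobeniusAlgHom F K) _ _
      rw [map_add, hφ, hφ, hφ, hx, ← map_pow, hpow, ← pow_mul, ← pow_succ] at hsum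
      simp_rw [← pow_mul, ← pow_succ] at hsum
      rw [hsum, Finset.sum_range_succ', map_add, pow_zero, pow_one]
      ring
  rw [Module.card_eq_pow_finrank (K := F) (V := K), key, FiniteField.algebraMap_trace_eq_sum_pow,
    Nat.card_eq_fintype_card]

/-- The additive polynomial map `x ↦ x ^ p - b * x` in characteristic `p`. -/
def powSubMulHom {R : Type*} [CommRing R] (p : ℕ) [Fact p.Prime] [CharP R p] (b : R) : R →+ R :=
  (frobenius R p).toAddMonoidHom - AddMonoidHom.mulLeft b

theorem powSubMulHom_apply {R : Type*} [CommRing R] (p : ℕ) [Fact p.Prime] [CharP R p] (b x : R) :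
    powSubMulHom p b x = x ^ p - b * x := by
  simp [powSubMulHom, frobenius_def]

theorem natCast_pow_char {R : Type*} [CommRing R] (p : ℕ) [Fact p.Prime] [CharP R p] (k : ℕ) :
    (k : R) ^ p = k := map_natCast (frobenius R p) k

theorem powSubMulHom_natCast_mul {R : Type*} [CommRing R] (p : ℕ) [Fact p.Prime] [CharP R p]
    (t : R) (k : ℕ) : powSubMulHom p (t ^ (p - 1)) (k * t) = 0 := by
  rw [powSubMulHom_apply, mul_pow, natCast_pow_char]
  have : t ^ p = t ^ (p - 1) * t := by
    rw [← pow_succ, Nat.sub_add_cancel (Fact.out : p.Prime).one_le]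
  rw [this]
  ring

/-- Monic polynomials of degree `n` over `K` agreeing at `n` points of an extension are equal. -/
theorem Polynomial.Monic.eq_of_aeval_finset_eq {K L : Type*} [Field K] [Field L] [Algebra K L]
    {f g : K[X]} (hf : f.Monic) (hg : g.Monic) (s : Finset L) (hfs : f.natDegree = s.card)
    (hgs : g.natDegree = s.card) (h : ∀ y ∈ s, aeval y f = aeval y g) : f = g := by
  apply Polynomial.map_injective _ (algebraMap K L).injective
  refine eq_of_degree_le_of_eval_finset_eq s ?_ ?_ ?_ ?_
  · simpa [hfs] using (f.map (algebraMap K L)).degree_le_natDegree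
  · rw [Polynomial.degree_map, Polynomial.degree_map, degree_eq_natDegree hf.ne_zero, degree_eq_natDegree hg.ne_zero,
      hfs, hgs]
  · rw [(hf.map (algebraMap K L)).leadingCoeff, (hg.map (algebraMap K L)).leadingCoeff]
  · simpa [eval_map_algebraMap] using h

theorem monic_X_pow_sub_C_mul_X_sub_C {R : Type*} [CommRing R] {n : ℕ} (hn : 1 < n)
    (b c : R) : (X ^ n - C b * X - C c : R[X]).Monic := by
  rw [sub_sub]
  exact monic_X_pow_sub (degree_linear_le.trans_lt (by exact_mod_cast hn))

theorem natDegree_X_pow_sub_C_mul_X_sub_C {R : Type*} [CommRing R] [Nontrivial R] {n : ℕ}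
    (hn : 1 < n) (b c : R) : (X ^ n - C b * X - C c : R[X]).natDegree = n := by
  rw [sub_sub, natDegree_sub_eq_left_of_natDegree_lt, natDegree_X_pow]
  rw [natDegree_X_pow]
  exact natDegree_linear_le.trans_lt hn

theorem card_image_add_natCast_mul {R : Type*} [CommRing R] [IsDomain R] [DecidableEq R] (p : ℕ)
    [CharP R p] {t : R} (ht : t ≠ 0) (y : R) :
    ((Finset.range p).image fun k : ℕ => y + k * t).card = p := by
  rw [Finset.card_image_of_injOn, Finset.card_range]
  intro i hi j hj hij
  exact CharP.natCast_injOn_Iio R p (by simpa using hi) (by simpa using hj)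
    (mul_right_cancel₀ ht (add_left_cancel hij))

/-- If Frobenius translates a root of a monic polynomial of degree `p` by a nonzero constant, then
the polynomial is irreducible. -/
theorem FiniteField.irreducible_of_pow_card_eq_add {K L : Type*} [Field K] [Fintype K] [Field L]
    [Algebra K L] (p : ℕ) [Fact p.Prime] [CharP L p] {f : K[X]} (hf : f.Monic)
    (hdeg : f.natDegree = p) {y : L} (hy : aeval y f = 0) {t : K} (ht : t ≠ 0)
    (hyt : y ^ Fintype.card K = y + algebraMap K L t) : Irreducible f := by
  classical
  have hint : IsIntegral K y := ⟨f, hf, hy⟩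
  have hroot (k : ℕ) : aeval (y + k * algebraMap K L t) (minpoly K y) = 0 := by
    induction k with
    | zero => simp
    | succ k ih =>
      have h := congrArg (frobeniusAlgHom K L) ih
      rw [← aeval_algHom_apply, map_zero, map_add, map_mul, map_natCast, AlgHom.commutes] at h
      change aeval (y ^ Fintype.card K + _) _ = _ at h
      rw [← h, hyt]
      congr 2
      push_cast
      ring
  have hcard := card_le_degree_of_subset_roots
    (p := (minpoly K y).map (algebraMap K L))
    (Z := (Finset.range p).image fun k : ℕ => y + k * algebraMap K L t) fun z hz => by
      obtain ⟨k, -, rfl⟩ := Finset.mem_image.1 (Finset.mem_def.2 hz)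
      rw [mem_roots ((minpoly.monic hint).map _).ne_zero, IsRoot, eval_map_algebraMap]
      exact hroot k
  rw [card_image_add_natCast_mul p (by simpa using ht), natDegree_map] at hcard
  rw [eq_of_monic_of_dvd_of_natDegree_le (minpoly.monic hint) hf (minpoly.dvd K y hy)
    (hdeg.trans_le hcard)]
  exact minpoly.irreducible hint

/-- For `t ≠ 0`, the kernel of `x ↦ x ^ p - t ^ (p - 1) * x` on a field has `p` elements. -/
theorem natCard_ker_powSubMulHom {F : Type*} [Field F] [Fintype F] (p : ℕ) [Fact p.Prime]
    [CharP F p] {t : F} (ht : t ≠ 0) :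
    Nat.card (powSubMulHom p (t ^ (p - 1))).ker = p := by
  classical
  have hp : 1 < p := (Fact.out : p.Prime).one_lt
  rw [Nat.card_eq_fintype_card]
  refine le_antisymm ?_ ?_
  · have h := card_le_degree_of_subset_roots (p := (X ^ p - C (t ^ (p - 1)) * X - C 0 : F[X]))
      (Z := Finset.univ.filter (· ∈ (powSubMulHom p (t ^ (p - 1))).ker)) fun z hz => by
        rw [mem_roots (monic_X_pow_sub_C_mul_X_sub_C hp _ _).ne_zero]
        simpa [AddMonoidHom.mem_ker, powSubMulHom_apply] using hz
    rwa [natDegree_X_pow_sub_C_mul_X_sub_C hp, ← Fintype.card_subtype] at h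
  · rw [Fintype.card_subtype]
    refine (card_image_add_natCast_mul p ht 0).symm.trans_le (Finset.card_le_card fun z hz => ?_)
    obtain ⟨k, -, rfl⟩ := Finset.mem_image.1 hz
    simp [AddMonoidHom.mem_ker, powSubMulHom_natCast_mul]

/-- Let `q = p^m ≥ 3`, `r ≥ 1`, and let `α ∈ F_{q^r}` satisfy
`Tr_{F_{q^r}/F_q}(α) ≠ 0`.  Then `T^q − T − α` factors in `F_{q^r}[T]` as the product of
`q/p` distinct monic irreducible polynomials, each of the form `T^p − βT − γᵢ` where
`β = Tr(α)^(p−1)` and the `γᵢ` are distinct nonzero elements of `F_{q^r}`. -/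
theorem stmt1 (p m r : ℕ) (hp : p.Prime) (hq3 : 3 ≤ p ^ m) (hr : 0 < r)
    (F K : Type*) [Field F] [Fintype F] [Field K] [Fintype K] [Algebra F K]
    (hF : Fintype.card F = p ^ m) (hK : Module.finrank F K = r)
    (α : K) (hα : Algebra.trace F K α ≠ 0) :
    ∃ γ : Fin (p ^ m / p) → K, Function.Injective γ ∧ (∀ i, γ i ≠ 0) ∧
      (∀ i, ((X : Polynomial K) ^ p
          - C (algebraMap F K ((Algebra.trace F K α) ^ (p - 1))) * X - C (γ i)).Monic ∧
        Irreducible ((X : Polynomial K) ^ p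
          - C (algebraMap F K ((Algebra.trace F K α) ^ (p - 1))) * X - C (γ i))) ∧
      (X : Polynomial K) ^ p ^ m - X - C α =
        ∏ i, ((X : Polynomial K) ^ p
          - C (algebraMap F K ((Algebra.trace F K α) ^ (p - 1))) * X - C (γ i)) := by
  classical
  have : Fact p.Prime := ⟨hp⟩
  have : CharP F p := charP_of_card_eq_prime_pow hF
  have : CharP K p := charP_of_injective_algebraMap (algebraMap F K).injective p
  let L := AlgebraicClosure K
  have : CharP L p := charP_of_injective_algebraMap (algebraMap K L).injective p
  have hm : m ≠ 0 := by rintro rfl; norm_num at hq3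
  have hdvd : p ∣ p ^ m := dvd_pow_self p hm
  have hpm : 1 < p ^ m := by lia
  set t := Algebra.trace F K α with ht
  set b : K := algebraMap F K (t ^ (p - 1)) with hb
  have hfmon := monic_X_pow_sub_C_mul_X_sub_C hpm 1 α
  have hfdeg := natDegree_X_pow_sub_C_mul_X_sub_C hpm 1 α
  rw [C_1, one_mul] at hfmon hfdeg
  obtain ⟨x, hx⟩ := IsAlgClosed.exists_aeval_eq_zero L (X ^ p ^ m - X - C α)
    (fun h => by rw [degree_eq_natDegree hfmon.ne_zero, hfdeg] at h; norm_cast at h; lia)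
  have hxq : x ^ p ^ m = x + algebraMap K L α := by
    simp only [map_sub, map_pow, aeval_X, aeval_C] at hx
    linear_combination hx
  have hxQ : x ^ Fintype.card K = x + algebraMap K L (algebraMap F K t) :=
    FiniteField.pow_card_eq_add_trace (hF.symm ▸ hxq)
  have hxaq (a : F) : (x + algebraMap K L (algebraMap F K a)) ^ p ^ m =
      x + algebraMap K L (algebraMap F K a) + algebraMap K L α := by
    rw [add_pow_char_pow, hxq, ← map_pow, ← map_pow, ← hF, FiniteField.pow_card]
    ring
  have hxaQ (a : F) : (x + algebraMap K L (algebraMap F K a)) ^ Fintype.card K =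
      x + algebraMap K L (algebraMap F K a) + algebraMap K L (algebraMap F K t) :=
    FiniteField.pow_card_eq_add_trace (hF.symm ▸ hxaq a)
  have hsub (a : F) : algebraMap F K (powSubMulHom p (t ^ (p - 1)) a) =
      powSubMulHom p b (algebraMap F K a) := by
    simp [powSubMulHom_apply, hb]
  have hsub' (a : K) : algebraMap K L (powSubMulHom p b a) =
      powSubMulHom p (algebraMap K L b) (algebraMap K L a) := by
    simp [powSubMulHom_apply]
  obtain ⟨c, hc⟩ : ∃ c : K, algebraMap K L c = powSubMulHom p (algebraMap K L b) x := by
    apply FiniteField.exists_algebraMap_eq_of_pow_card_eq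
    have h1 : powSubMulHom p (algebraMap K L b) x ^ Fintype.card K =
        powSubMulHom p (algebraMap K L b) (x ^ Fintype.card K) := by
      change FiniteField.frobeniusAlgHom K L _ = _
      rw [powSubMulHom_apply, map_sub, map_pow, map_mul, AlgHom.commutes, powSubMulHom_apply]
      rfl
    rw [h1, hxQ, map_add, ← hsub', ← hsub]
    have := powSubMulHom_natCast_mul p t 1
    rw [Nat.cast_one, one_mul] at this
    rw [this, map_zero, map_zero, add_zero]
  have hcard : Nat.card (powSubMulHom p (t ^ (p - 1))).range = p ^ m / p := by
    have h := (powSubMulHom p (t ^ (p - 1))).ker.card_mul_index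
    rw [AddSubgroup.index_ker, natCard_ker_powSubMulHom p hα, Nat.card_eq_fintype_card (α := F),
      hF] at h
    exact (Nat.div_eq_of_eq_mul_right hp.pos h.symm).symm
  let e := (Finite.equivFinOfCardEq hcard).symm
  let γ : Fin (p ^ m / p) → K := fun i => c + algebraMap F K (e i)
  have hroot (a : F) (i) (ha : powSubMulHom p (t ^ (p - 1)) a = e i) :
      aeval (x + algebraMap K L (algebraMap F K a)) (X ^ p - C b * X - C (γ i)) = 0 := by
    have h : aeval (x + algebraMap K L (algebraMap F K a)) (X ^ p - C b * X - C (γ i)) =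
        powSubMulHom p (algebraMap K L b) (x + algebraMap K L (algebraMap F K a)) -
          algebraMap K L (γ i) := by
      simp [powSubMulHom_apply]
    rw [h, map_add, ← hc, ← hsub', ← hsub, ha, map_add, sub_self]
  have hmon (i) := monic_X_pow_sub_C_mul_X_sub_C hp.one_lt b (γ i)
  have hdeg (i) := natDegree_X_pow_sub_C_mul_X_sub_C hp.one_lt b (γ i)
  have hirr (i) : Irreducible (X ^ p - C b * X - C (γ i)) := by
    obtain ⟨a, ha⟩ := (e i).2
    exact FiniteField.irreducible_of_pow_card_eq_add p (hmon i) (hdeg i) (hroot a i ha)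
      (by simpa using hα) (hxaQ a)
  refine ⟨γ, ?_, ?_, fun i => ⟨hmon i, hirr i⟩, ?_⟩
  · intro i j hij
    exact e.injective (Subtype.ext ((algebraMap F K).injective (add_left_cancel hij)))
  · intro i hi
    have h := degree_eq_one_of_irreducible_of_root (hirr i) (x := 0) (by simp [hi, hp.ne_zero])
    rw [degree_eq_natDegree (hmon i).ne_zero, hdeg i] at h
    exact hp.one_lt.ne' (by exact_mod_cast h)
  · have hinj : Function.Injective fun a : F => x + algebraMap K L (algebraMap F K a) :=
      fun a a' h => (algebraMap F K).injective ((algebraMap K L).injective (add_left_cancel h))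
    refine hfmon.eq_of_aeval_finset_eq (monic_prod_of_monic _ _ fun i _ => hmon i)
      (Finset.univ.image fun a : F => x + algebraMap K L (algebraMap F K a)) ?_ ?_ ?_
    · rw [Finset.card_image_of_injective _ hinj, Finset.card_univ, hF, hfdeg]
    · rw [Finset.card_image_of_injective _ hinj, Finset.card_univ, hF,
        natDegree_prod_of_monic _ _ fun i _ => hmon i]
      simp [hdeg, Nat.div_mul_cancel hdvd]
    · intro y hy
      obtain ⟨a, -, rfl⟩ := Finset.mem_image.1 hy
      rw [map_prod, Finset.prod_eq_zero
        (Finset.mem_univ (e.symm ⟨powSubMulHom p (t ^ (p - 1)) a, a, rfl⟩))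
        (hroot a _ (by simp))]
      simp [hxaq]
end

section
/- Let q = p^m ≥ 3 and s ≥ 1. A monic irreducible polynomial P ∈ F_q[T] is a non-fixed c-Wieferich prime of degree s (i.e., a c-Wieferich prime whose translation stabilizer in F_q is trivial) if and only if there exists α ∈ F_{q^s} of degree s over F_q such that Tr_{F_{q^s}/F_q}(α) = 0, F_{s−1} ≡ 0 (mod T^q − T − α) in F_{q^s}[T], and P divides ∏_{i=1}^{s} (T^q − T − α^{q^i}). -/
open Polynomial

/-- The sequence of polynomials `F_0 = 1`, `F_i = (−1)^i + (T^{q^i} − T)·F_{i−1}`. -/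
noncomputable def Fseq (q : ℕ) (K : Type*) [Field K] : ℕ → Polynomial K
  | 0 => 1
  | i + 1 => (-1 : Polynomial K) ^ (i + 1) + (X ^ q ^ (i + 1) - X) * Fseq q K i

theorem FiniteField.X_pow_card_sub_X_eq_prod (F : Type*) [Field F] [Fintype F] :
    (X ^ Fintype.card F - X : F[X]) = ∏ a : F, (X - C a) := by
  have hdeg := FiniteField.X_pow_card_sub_X_natDegree_eq F (Fintype.one_lt_card (α := F))
  have hmon : (X ^ Fintype.card F - X : F[X]).Monic :=
    monic_X_pow_sub (by rw [degree_X]; exact_mod_cast Fintype.one_lt_card)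
  have h := prod_multiset_X_sub_C_of_monic_of_roots_card_eq hmon
    (by rw [hdeg, FiniteField.roots_X_pow_card_sub_X]; rfl)
  rw [FiniteField.roots_X_pow_card_sub_X] at h
  exact h.symm

theorem FiniteField.mem_range_algebraMap_of_pow_card_eq (F : Type*) {L : Type*} [Field F]
    [Fintype F] [CommRing L] [IsDomain L] [Algebra F L] {y : L} (hy : y ^ Fintype.card F = y) :
    ∃ a : F, algebraMap F L a = y := by
  have h := congrArg (aeval y) (FiniteField.X_pow_card_sub_X_eq_prod F)
  simp only [map_sub, map_pow, aeval_X, hy, sub_self, map_prod, aeval_C] at h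
  obtain ⟨a, -, ha⟩ := Finset.prod_eq_zero_iff.mp h.symm
  exact ⟨a, (sub_eq_zero.mp ha).symm⟩

theorem FiniteField.sub_pow_card (F : Type*) {R : Type*} [Field F] [Fintype F] [CommRing R]
    [Algebra F R] (x y : R) :
    (x - y) ^ Fintype.card F = x ^ Fintype.card F - y ^ Fintype.card F :=
  map_sub (FiniteField.frobeniusAlgHom F R) x y

theorem FiniteField.add_algebraMap_pow_card (F : Type*) {R : Type*} [Field F] [Fintype F]
    [CommRing R] [Algebra F R] (x : R) (a : F) :
    (x + algebraMap F R a) ^ Fintype.card F = x ^ Fintype.card F + algebraMap F R a := by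
  simpa [FiniteField.coe_frobeniusAlgHom] using
    map_add (FiniteField.frobeniusAlgHom F R) x (algebraMap F R a)

theorem FiniteField.add_algebraMap_pow_card_pow (F : Type*) {R : Type*} [Field F] [Fintype F]
    [CommRing R] [Algebra F R] (x : R) (a : F) (n : ℕ) :
    (x + algebraMap F R a) ^ Fintype.card F ^ n =
      x ^ Fintype.card F ^ n + algebraMap F R a := by
  induction n with
  | zero => simp
  | succ n ih => rw [pow_succ, pow_mul, ih, FiniteField.add_algebraMap_pow_card, ← pow_mul]

theorem FiniteField.artinSchreier_eq_prod {F K : Type*} [Field F] [Fintype F] [Field K]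
    [Algebra F K] (θ : K) :
    (X ^ Fintype.card F - X - C (θ ^ Fintype.card F - θ) : K[X]) =
      ∏ a : F, (X - C (θ + algebraMap F K a)) := by
  have h := congrArg (aeval (X - C θ : K[X])) (FiniteField.X_pow_card_sub_X_eq_prod F)
  simp only [map_sub, map_pow, aeval_X, map_prod, aeval_C, FiniteField.sub_pow_card] at h
  rw [map_sub, map_pow, show ∀ a b c d : K[X], a - b - (c - d) = a - c - (b - d) by intros; ring,
    h]
  refine Finset.prod_congr rfl fun a _ => ?_
  rw [map_add, sub_sub]
  rfl

theorem FiniteField.exists_pow_succ_eq {F K : Type*} [Field F] [Fintype F] [Field K] [Finite K]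
    [Algebra F K] (σ : Gal(K/F)) :
    ∃ i < Module.finrank F K, ∀ x, σ x = x ^ Fintype.card F ^ (i + 1) := by
  obtain ⟨⟨i, hi⟩, h⟩ := (FiniteField.bijective_frobeniusAlgEquivOfAlgebraic_pow F K).2
    (σ * (FiniteField.frobeniusAlgEquivOfAlgebraic F K)⁻¹)
  refine ⟨i, hi, fun x => ?_⟩
  rw [eq_mul_inv_iff_mul_eq, ← pow_succ] at h
  rw [← h, AlgEquiv.coe_pow, FiniteField.coe_frobeniusAlgEquivOfAlgebraic_iterate]

theorem FiniteField.exists_algEquiv_eq_pow (F K : Type*) [Field F] [Fintype F] [Field K]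
    [Finite K] [Algebra F K] (i : ℕ) :
    ∃ σ : Gal(K/F), ∀ x, σ x = x ^ Fintype.card F ^ i :=
  ⟨FiniteField.frobeniusAlgEquivOfAlgebraic F K ^ i, fun x => by
    rw [AlgEquiv.coe_pow, FiniteField.coe_frobeniusAlgEquivOfAlgebraic_iterate]⟩

theorem IsGalois.natDegree_minpoly_eq_finrank_iff {F K : Type*} [Field F] [Field K] [Algebra F K]
    [FiniteDimensional F K] [IsGalois F K] {α : K} :
    (minpoly F α).natDegree = Module.finrank F K ↔ ∀ σ : Gal(K/F), σ α = α → σ = 1 := by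
  rw [← Field.primitive_element_iff_minpoly_natDegree_eq]
  constructor
  · intro h σ hσ
    have hmem : σ ∈ (IntermediateField.adjoin F {α}).fixingSubgroup := by
      rw [IntermediateField.mem_fixingSubgroup_iff]
      intro x hx
      exact IntermediateField.adjoin_induction F (p := fun x _ => σ x = x)
        (fun x hx => by rw [Set.mem_singleton_iff.mp hx, hσ]) (fun x => σ.commutes x)
        (fun x y _ _ hx hy => by rw [map_add, hx, hy]) (fun x _ hx => by rw [map_inv₀, hx])
        (fun x y _ _ hx hy => by rw [map_mul, hx, hy]) hx
    rw [h, IntermediateField.fixingSubgroup_top] at hmem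
    exact Subgroup.mem_bot.mp hmem
  · intro h
    have hbot : (IntermediateField.adjoin F {α}).fixingSubgroup = ⊥ := by
      rw [Subgroup.eq_bot_iff_forall]
      intro σ hσ
      refine h σ ((IntermediateField.mem_fixingSubgroup_iff _ _).mp hσ α ?_)
      exact IntermediateField.mem_adjoin_simple_self F α
    rw [← IsGalois.fixedField_fixingSubgroup (IntermediateField.adjoin F {α}), hbot,
      IntermediateField.fixedField_bot]

theorem Polynomial.dvd_of_irreducible_of_aeval_eq_zero {F L : Type*} [Field F] [CommRing L]
    [Nontrivial L] [Algebra F L] {P Q : F[X]} {y : L} (hmon : P.Monic) (hirr : Irreducible P)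
    (hP : aeval y P = 0) (hQ : aeval y Q = 0) : P ∣ Q := by
  rw [minpoly.eq_of_irreducible_of_monic hirr hP hmon]
  exact minpoly.dvd F y hQ

theorem Polynomial.comp_X_add_C_eq_self_iff {F L : Type*} [Field F] [CommRing L]
    [Nontrivial L] [Algebra F L] {P : F[X]} {y : L} (hmon : P.Monic) (hirr : Irreducible P)
    (hP : aeval y P = 0) (a : F) :
    P.comp (X + C a) = P ↔ aeval (y + algebraMap F L a) P = 0 := by
  have hcomp : aeval y (P.comp (X + C a)) = aeval (y + algebraMap F L a) P := by
    simp [aeval_comp]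
  constructor
  · intro h
    rw [← hcomp, h, hP]
  · intro h
    refine (eq_of_monic_of_dvd_of_natDegree_le hmon (hmon.comp_X_add_C a)
      (dvd_of_irreducible_of_aeval_eq_zero hmon hirr hP (hcomp.trans h)) ?_)
    simp [natDegree_comp]

theorem Fseq_map (q : ℕ) {F K : Type*} [Field F] [Field K] [Algebra F K] (i : ℕ) :
    (Fseq q F i).map (algebraMap F K) = Fseq q K i := by
  induction i with
  | zero => simp [Fseq]
  | succ i ih => simp [Fseq, ih]

theorem aeval_Fseq (q : ℕ) {F K : Type*} [Field F] [Field K] [Algebra F K] (x : K) (i : ℕ) :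
    aeval x (Fseq q F i) = (Fseq q K i).eval x := by
  rw [← Fseq_map (F := F) (K := K), eval_map_algebraMap]

theorem Fseq_eval_add_algebraMap {F K : Type*} [Field F] [Fintype F] [Field K] [Algebra F K]
    (x : K) (a : F) (i : ℕ) :
    (Fseq (Fintype.card F) K i).eval (x + algebraMap F K a) =
      (Fseq (Fintype.card F) K i).eval x := by
  induction i with
  | zero => simp [Fseq]
  | succ i ih =>
    simp [Fseq, ih, FiniteField.add_algebraMap_pow_card_pow]

theorem artinSchreier_dvd_Fseq_iff {F K : Type*} [Field F] [Fintype F] [Field K] [Algebra F K]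
    (θ : K) (i : ℕ) :
    (X ^ Fintype.card F - X - C (θ ^ Fintype.card F - θ) : K[X]) ∣ Fseq (Fintype.card F) K i ↔
      (Fseq (Fintype.card F) K i).eval θ = 0 := by
  constructor
  · intro h
    exact eval_eq_zero_of_dvd_of_eval_eq_zero h (by simp)
  · intro h
    rw [FiniteField.artinSchreier_eq_prod]
    refine Finset.prod_dvd_of_coprime ?_ fun a _ => ?_
    · exact (pairwise_coprime_X_sub_C
        ((add_right_injective θ).comp (algebraMap F K).injective)).set_pairwise _
    · rw [dvd_iff_isRoot, IsRoot.def, Fseq_eval_add_algebraMap, h]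

theorem FiniteField.trace_pow_card_sub_self {F K : Type*} [Field F] [Fintype F] [Field K]
    [Finite K] [Algebra F K] (θ : K) : Algebra.trace F K (θ ^ Fintype.card F - θ) = 0 := by
  have h := Algebra.trace_eq_of_algEquiv (FiniteField.frobeniusAlgEquivOfAlgebraic F K) θ
  rw [FiniteField.coe_frobeniusAlgEquivOfAlgebraic] at h
  rw [map_sub, sub_eq_zero]
  exact h

theorem FiniteField.pow_card_eq_self_of_trace_eq_zero {F K L : Type*} [Field F] [Fintype F]
    [Field K] [Fintype K] [Algebra F K] [Field L] [Algebra F L] [Algebra K L] {α : K} {y : L}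
    (hα : Algebra.trace F K α = 0) (hy : y ^ Fintype.card F - y = algebraMap K L α) :
    y ^ Fintype.card K = y := by
  have hsum : ∀ n, ∑ i ∈ Finset.range n, algebraMap K L α ^ Fintype.card F ^ i =
      y ^ Fintype.card F ^ n - y := by
    intro n
    induction n with
    | zero => simp
    | succ n ih =>
      have h := map_sub (FiniteField.frobeniusAlgHom F L ^ n) (y ^ Fintype.card F) y
      simp only [AlgHom.coe_pow, FiniteField.coe_frobeniusAlgHom, pow_iterate] at h
      rw [Finset.sum_range_succ, ih, ← hy, h, ← pow_mul, ← pow_succ']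
      ring
  have h := congrArg (algebraMap K L) (FiniteField.algebraMap_trace_eq_sum_pow F K α)
  rw [hα, map_zero, map_zero, map_sum, Nat.card_eq_fintype_card] at h
  simp only [map_pow] at h
  rw [hsum, ← Module.card_eq_pow_finrank] at h
  exact sub_eq_zero.mp h.symm

theorem FiniteField.exists_aeval_eq_zero_of_natDegree_eq_finrank {F K : Type*} [Field F]
    [Fintype F] [Field K] [Fintype K] [Algebra F K] {P : F[X]} (hirr : Irreducible P)
    (hP : P.natDegree = Module.finrank F K) : ∃ θ : K, aeval θ P = 0 := by
  have hdvd := (hirr.natDegree_dvd_iff_dvd_X_pow_card_pow_sub_X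
    (n := Module.finrank F K)).mp hP.dvd
  rw [Nat.card_eq_fintype_card, ← Module.card_eq_pow_finrank] at hdvd
  obtain ⟨y, hy⟩ := IsAlgClosed.exists_aeval_eq_zero (AlgebraicClosure K) P
    (degree_pos_of_irreducible hirr).ne'
  have hy' : y ^ Fintype.card K = y := by
    have := aeval_eq_zero_of_dvd_aeval_eq_zero hdvd hy
    simpa [sub_eq_zero] using this
  obtain ⟨θ, rfl⟩ := FiniteField.mem_range_algebraMap_of_pow_card_eq K hy'
  rw [aeval_algebraMap_apply] at hy
  exact ⟨θ, by simpa using hy⟩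

theorem FiniteField.apply_artinSchreier {F K : Type*} [Field F] [Fintype F] [Field K]
    [Algebra F K] (σ : Gal(K/F)) (θ : K) :
    σ (θ ^ Fintype.card F - θ) = σ θ ^ Fintype.card F - σ θ := by
  rw [map_sub, map_pow]

theorem FiniteField.map_dvd_prod_artinSchreier {F K : Type*} [Field F] [Fintype F] [Field K]
    [Fintype K] [Algebra F K] {P : F[X]} (hmon : P.Monic) (hirr : Irreducible P) {θ : K}
    (hθ : aeval θ P = 0) :
    P.map (algebraMap F K) ∣ ∏ i ∈ Finset.range (Module.finrank F K),
      ((X : K[X]) ^ Fintype.card F - X -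
        C ((θ ^ Fintype.card F - θ) ^ Fintype.card F ^ (i + 1))) := by
  have hmin := minpoly.eq_of_irreducible_of_monic hirr hθ hmon
  have hsplit : (P.map (algebraMap F K)).Splits := hmin ▸ Normal.splits inferInstance θ
  have hsep : P.Separable := hmin ▸ Algebra.IsSeparable.isSeparable F θ
  have hprod : (∏ i ∈ Finset.range (Module.finrank F K), ((X : K[X]) ^ Fintype.card F - X -
      C ((θ ^ Fintype.card F - θ) ^ Fintype.card F ^ (i + 1)))) ≠ 0 := by
    refine Finset.prod_ne_zero_iff.mpr fun i _ => ?_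
    obtain ⟨σ, hσ⟩ := FiniteField.exists_algEquiv_eq_pow F K (i + 1)
    rw [← hσ, FiniteField.apply_artinSchreier, FiniteField.artinSchreier_eq_prod]
    exact Finset.prod_ne_zero_iff.mpr fun a _ => X_sub_C_ne_zero _
  refine hsplit.dvd_of_roots_le_roots (map_ne_zero hmon.ne_zero) ?_
  rw [Multiset.le_iff_subset (nodup_roots hsep.map)]
  intro x hx
  have hx0 : aeval x P = 0 := by
    rw [mem_roots (map_ne_zero hmon.ne_zero), IsRoot.def, eval_map_algebraMap] at hx
    exact hx
  have hconj : IsConjRoot F θ x := by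
    rw [isConjRoot_def, ← hmin]
    exact minpoly.eq_of_irreducible_of_monic hirr hx0 hmon
  obtain ⟨σ, rfl⟩ := hconj.symm.exists_algEquiv
  obtain ⟨i, hi, hσ⟩ := FiniteField.exists_pow_succ_eq σ
  rw [mem_roots hprod, IsRoot.def, eval_prod]
  refine Finset.prod_eq_zero (Finset.mem_range.mpr hi) ?_
  rw [← hσ (θ ^ Fintype.card F - θ), FiniteField.apply_artinSchreier]
  simp

/-- Let `q = p^m ≥ 3` and `s ≥ 1`.  A monic irreducible polynomial
`P ∈ F_q[T]` is a non-fixed c-Wieferich prime of degree `s` (its translation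
stabilizer in `F_q` is trivial) if and only if there exists `α ∈ F_{q^s}` of degree
`s` over `F_q` with `Tr_{F_{q^s}/F_q}(α) = 0`, `F_{s−1} ≡ 0 (mod T^q − T − α)` in
`F_{q^s}[T]`, and `P` divides `∏_{i=1}^{s} (T^q − T − α^{q^i})`. -/
theorem stmt8 (p m s : ℕ) (hp : p.Prime) (hq3 : 3 ≤ p ^ m) (hs : 0 < s)
    (F K : Type*) [Field F] [Fintype F] [Field K] [Fintype K] [Algebra F K]
    (hF : Fintype.card F = p ^ m) (hK : Module.finrank F K = s)
    (P : Polynomial F) (hmon : P.Monic) (hirr : Irreducible P) :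
    ((∀ a : F, P.comp (X + C a) = P → a = 0) ∧ P.natDegree = s ∧
        P ∣ Fseq (p ^ m) F (s - 1)) ↔
      ∃ α : K, (minpoly F α).natDegree = s ∧ Algebra.trace F K α = 0 ∧
        ((X : Polynomial K) ^ p ^ m - X - C α) ∣ Fseq (p ^ m) K (s - 1) ∧
        P.map (algebraMap F K) ∣
          ∏ i ∈ Finset.range s,
            ((X : Polynomial K) ^ p ^ m - X - C (α ^ (p ^ m) ^ (i + 1))) := by
  subst hK
  rw [← hF]
  clear hF hq3
  have : IsGalois F K := inferInstance
  constructor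
  · rintro ⟨hfix, hdeg, hdvd⟩
    obtain ⟨θ, hθ⟩ := FiniteField.exists_aeval_eq_zero_of_natDegree_eq_finrank hirr hdeg
    have hmin := minpoly.eq_of_irreducible_of_monic hirr hθ hmon
    refine ⟨θ ^ Fintype.card F - θ, ?_, FiniteField.trace_pow_card_sub_self θ, ?_,
      FiniteField.map_dvd_prod_artinSchreier hmon hirr hθ⟩
    · rw [IsGalois.natDegree_minpoly_eq_finrank_iff]
      intro σ hσ
      rw [FiniteField.apply_artinSchreier] at hσ
      obtain ⟨a, ha⟩ := FiniteField.mem_range_algebraMap_of_pow_card_eq F (y := σ θ - θ) (by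
        rw [FiniteField.sub_pow_card]; linear_combination hσ)
      have hσθ : σ θ = θ + algebraMap F K a := by rw [ha]; ring
      have ha0 : a = 0 := by
        refine hfix a ((comp_X_add_C_eq_self_iff hmon hirr hθ a).mpr ?_)
        rw [← hσθ, ← AlgEquiv.coe_toAlgHom, aeval_algHom_apply, hθ, map_zero]
      rw [hmin] at hdeg
      exact IsGalois.natDegree_minpoly_eq_finrank_iff.mp hdeg σ (by rw [hσθ, ha0]; simp)
    · rw [artinSchreier_dvd_Fseq_iff, ← aeval_Fseq (F := F)]
      exact aeval_eq_zero_of_dvd_aeval_eq_zero hdvd hθ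
  · rintro ⟨α, hdeg, htr, hdvd, hprod⟩
    rw [IsGalois.natDegree_minpoly_eq_finrank_iff] at hdeg
    obtain ⟨τ, θ, hτ, hθ⟩ : ∃ (τ : Gal(K/F)) (θ : K),
        θ ^ Fintype.card F - θ = τ α ∧ aeval θ P = 0 := by
      obtain ⟨y, hy⟩ := IsAlgClosed.exists_aeval_eq_zero (AlgebraicClosure K) P
        (degree_pos_of_irreducible hirr).ne'
      have h := aeval_eq_zero_of_dvd_aeval_eq_zero hprod (x := y) (by
        rwa [aeval_map_algebraMap])
      rw [map_prod] at h
      obtain ⟨i, -, hi⟩ := Finset.prod_eq_zero_iff.mp h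
      obtain ⟨τ, hτ⟩ := FiniteField.exists_algEquiv_eq_pow F K (i + 1)
      rw [← hτ] at hi
      have hy' : y ^ Fintype.card F - y = algebraMap K (AlgebraicClosure K) (τ α) := by
        simpa [sub_eq_zero] using hi
      obtain ⟨θ, rfl⟩ := FiniteField.mem_range_algebraMap_of_pow_card_eq K
        (FiniteField.pow_card_eq_self_of_trace_eq_zero
          ((Algebra.trace_eq_of_algEquiv τ α).trans htr) hy')
      rw [← map_pow, ← map_sub] at hy'
      rw [aeval_algebraMap_apply] at hy
      exact ⟨τ, θ, (algebraMap K (AlgebraicClosure K)).injective hy', by simpa using hy⟩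
    have hstab : ∀ σ : Gal(K/F), σ (τ α) = τ α → σ = 1 := by
      intro σ hσ
      have h := hdeg (τ⁻¹ * σ * τ) (by
        rw [AlgEquiv.mul_apply, AlgEquiv.mul_apply, hσ, ← AlgEquiv.mul_apply, inv_mul_cancel,
          AlgEquiv.one_apply])
      rwa [mul_assoc, inv_mul_eq_one, right_eq_mul] at h
    have hmin := minpoly.eq_of_irreducible_of_monic hirr hθ hmon
    refine ⟨fun a ha => ?_, ?_, ?_⟩
    · have hroot := (comp_X_add_C_eq_self_iff hmon hirr hθ a).mp ha
      have hconj : IsConjRoot F (θ + algebraMap F K a) θ := by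
        rw [isConjRoot_def, ← hmin]
        exact (minpoly.eq_of_irreducible_of_monic hirr hroot hmon).symm
      obtain ⟨σ, hσ⟩ := hconj.exists_algEquiv
      have h1 : σ = 1 := hstab σ (by
        rw [← hτ, FiniteField.apply_artinSchreier, hσ, FiniteField.add_algebraMap_pow_card]
        ring)
      rw [h1, AlgEquiv.one_apply] at hσ
      simpa using hσ
    · rw [hmin, IsGalois.natDegree_minpoly_eq_finrank_iff]
      intro σ hσ
      exact hstab σ (by rw [← hτ, FiniteField.apply_artinSchreier, hσ])
    · have hα : α = (τ⁻¹ θ) ^ Fintype.card F - τ⁻¹ θ := by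
        rw [← FiniteField.apply_artinSchreier, hτ, ← AlgEquiv.mul_apply, inv_mul_cancel,
          AlgEquiv.one_apply]
      rw [hα, artinSchreier_dvd_Fseq_iff, ← aeval_Fseq (F := F)] at hdvd
      refine dvd_of_irreducible_of_aeval_eq_zero hmon hirr (y := τ⁻¹ θ) ?_ hdvd
      rw [← AlgEquiv.coe_toAlgHom, aeval_algHom_apply, hθ, map_zero]
end
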